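/- For a scalable (w,N)-solution, N(N+1)/2 ≤ 3^w; equivalently, N ≤ ⌊√(2·3^w + 1/4) − 1/2⌋. -/

import Mathlib

/-- An adaptive strategy for balance weighings on `N` coins: a ternary decision
tree.  At a `weigh A B` node the sets `A` and `B` are placed on the two pans,
and the strategy branches on the outcome (`.lt`: left pan lighter, `.eq`:
balance, `.gt`: right pan lighter).  A leaf `output S` outputs the set `S` of
coins. -/
inductive FCTree (N : ℕ) : Type
  | output (S : Finset (Fin N)) : FCTree N
  | weigh (A B : Finset (Fin N)) (child : Ordering → FCTree N) : FCTree N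

namespace FCTree

/-- The depth (number of weighings in the worst case) of a strategy. -/
def depth {N : ℕ} : FCTree N → ℕ
  | output _ => 0
  | weigh _ _ child =>
      1 + max (depth (child .lt)) (max (depth (child .eq)) (depth (child .gt)))

/-- A strategy is well-formed if in every weighing the two pans are disjoint. -/
def WF {N : ℕ} : FCTree N → Prop
  | output _ => True
  | weigh A B child => Disjoint A B ∧ ∀ o, WF (child o)

end FCTree

/-- Weight of coin `x` when `f` is the fake coin, `c` is the chameleon, and the
chameleon chooses to weigh as a fake coin iff `b = true`.  Real coins weigh `1`
and the (lighter) fake coin weighs `0`. -/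
def coinWeight {N : ℕ} (f c : Fin N) (b : Bool) (x : Fin N) : ℕ :=
  if x = f then 0 else if x = c ∧ b = true then 0 else 1

/-- The outcome of weighing pan `A` against pan `B`, with fake `f`, chameleon
`c`, and chameleon choice `b`. -/
def weighOutcome {N : ℕ} (f c : Fin N) (b : Bool) (A B : Finset (Fin N)) : Ordering :=
  compare (∑ x ∈ A, coinWeight f c b x) (∑ x ∈ B, coinWeight f c b x)

/-- `Reaches f c t S` holds if, with fake coin `f` and chameleon `c`, some
sequence of choices by the chameleon (one choice before each weighing,
independently) leads the strategy `t` to output the set `S`. -/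
inductive Reaches {N : ℕ} (f c : Fin N) : FCTree N → Finset (Fin N) → Prop
  | output (S : Finset (Fin N)) : Reaches f c (.output S) S
  | weigh (A B : Finset (Fin N)) (child : Ordering → FCTree N) (b : Bool)
      (S : Finset (Fin N)) :
      Reaches f c (child (weighOutcome f c b A B)) S →
      Reaches f c (.weigh A B child) S

/-- `t` is an FC-solution for `N` coins in `w` weighings: a well-formed strategy
of depth at most `w` which, for every placement of the fake coin and the
chameleon and every sequence of choices by the chameleon, outputs a set of at
most 2 coins containing the fake coin. -/
def IsFCSolution {N : ℕ} (t : FCTree N) (w : ℕ) : Prop :=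
  t.WF ∧ t.depth ≤ w ∧
    ∀ f c : Fin N, f ≠ c → ∀ S, Reaches f c t S → S.card ≤ 2 ∧ f ∈ S

/-- There is an FC-algorithm in `w` weighings for `N` coins. -/
def FCAlgorithm (N w : ℕ) : Prop := ∃ t : FCTree N, IsFCSolution t w

/-- `FC N` is the least number of weighings `w` for which an FC-algorithm in
`w` weighings for `N` coins exists. -/
noncomputable def FC (N : ℕ) : ℕ := sInf {w | FCAlgorithm N w}

/-- Weight of coin `x` in the FF-problem with fake coins `f₁` and `f₂`. -/
def ffWeight {N : ℕ} (f₁ f₂ x : Fin N) : ℕ := if x = f₁ ∨ x = f₂ then 0 else 1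

/-- The (deterministic) run of a strategy in the FF-problem with fake coins
`f₁` and `f₂`; it returns the output set. -/
def ffRun {N : ℕ} (f₁ f₂ : Fin N) : FCTree N → Finset (Fin N)
  | .output S => S
  | .weigh A B child =>
      ffRun f₁ f₂
        (child (compare (∑ x ∈ A, ffWeight f₁ f₂ x) (∑ x ∈ B, ffWeight f₁ f₂ x)))

/-- There is an FF-algorithm in `w` weighings for `N` coins: a well-formed
strategy of depth at most `w` that identifies both fake coins for every
placement of the two fake coins. -/
def FFAlgorithm (N w : ℕ) : Prop :=
  ∃ t : FCTree N, t.WF ∧ t.depth ≤ w ∧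
    ∀ f₁ f₂ : Fin N, f₁ ≠ f₂ → ffRun f₁ f₂ t = {f₁, f₂}

/-- The group (of three coins) to which a coin of the scaled problem belongs. -/
def coinGroup {N : ℕ} (x : Fin (3 * N)) : Fin N :=
  ⟨x.val / 3, by have := x.isLt; omega⟩

/-- The set of coins of the scaled problem whose group lies in `A`. -/
def expandPan {N : ℕ} (A : Finset (Fin N)) : Finset (Fin (3 * N)) :=
  Finset.univ.filter (fun x => coinGroup x ∈ A)

/-- The scaling of a strategy, extended at the leaves: every coin is replaced
by a group of three coins, every weighing is performed on the corresponding
groups, and every leaf `output S` is replaced by the strategy `ext S`. -/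
def scaleExtend {N : ℕ} (ext : Finset (Fin N) → FCTree (3 * N)) :
    FCTree N → FCTree (3 * N)
  | .output S => ext S
  | .weigh A B child =>
      .weigh (expandPan A) (expandPan B) (fun o => scaleExtend ext (child o))

/-- A `(w,N)`-solution `t` is scalable if its scaling can be extended by (at
most) two further weighings at each leaf to a `(w+2, 3N)`-solution. -/
def IsScalable {N : ℕ} (t : FCTree N) (w : ℕ) : Prop :=
  ∃ ext : Finset (Fin N) → FCTree (3 * N),
    (∀ S, (ext S).WF ∧ (ext S).depth ≤ 2) ∧
    IsFCSolution (scaleExtend ext t) (w + 2)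

namespace FCTree

variable {N : ℕ}

/-- The sets that occur at the leaves of a strategy. -/
def outputs : FCTree N → Finset (Finset (Fin N))
  | output S => {S}
  | weigh _ _ child => outputs (child .lt) ∪ (outputs (child .eq) ∪ outputs (child .gt))

theorem outputs_child_subset (A B : Finset (Fin N)) (child : Ordering → FCTree N)
    (o : Ordering) : (child o).outputs ⊆ (weigh A B child).outputs := by
  intro S hS
  cases o <;> simp [outputs, hS]

theorem card_outputs_le (t : FCTree N) : t.outputs.card ≤ 3 ^ t.depth := by
  induction t with
  | output S => simp [outputs, depth]
  | weigh A B child ih =>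
    set m := max (child .lt).depth (max (child .eq).depth (child .gt).depth) with hm
    have bound : ∀ o, (child o).outputs.card ≤ 3 ^ m := fun o =>
      (ih o).trans (Nat.pow_le_pow_right (by norm_num) (by cases o <;> simp [hm]))
    calc (weigh A B child).outputs.card
        ≤ (child .lt).outputs.card + ((child .eq).outputs.card + (child .gt).outputs.card) :=
          (Finset.card_union_le _ _).trans
            (Nat.add_le_add_left (Finset.card_union_le _ _) _)
      _ ≤ 3 ^ m + (3 ^ m + 3 ^ m) :=
          Nat.add_le_add (bound _) (Nat.add_le_add (bound _) (bound _))
      _ = 3 ^ (weigh A B child).depth := by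
          simp only [depth, ← hm, pow_add]
          ring

end FCTree

section Weights

variable {N : ℕ}

theorem ffRun_mem_outputs (x y : Fin N) (t : FCTree N) : ffRun x y t ∈ t.outputs := by
  induction t with
  | output S => simp [ffRun, FCTree.outputs]
  | weigh A B child ih => exact FCTree.outputs_child_subset A B child _ (ih _)

theorem ffRun_comm (x y : Fin N) (t : FCTree N) : ffRun x y t = ffRun y x t := by
  have h : (ffWeight x y : Fin N → ℕ) = ffWeight y x := by
    funext z
    simp [ffWeight, or_comm]
  induction t with
  | output S => rfl
  | weigh A B child ih => simp only [ffRun, h, ih]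

theorem coinWeight_true (x y : Fin N) : coinWeight x y true = ffWeight x y := by
  funext z
  by_cases h : z = x <;> simp [coinWeight, ffWeight, h]

theorem coinWeight_false (x y : Fin N) : coinWeight x y false = ffWeight x x := by
  funext z
  simp [coinWeight, ffWeight]

/-- A chameleon that always weighs as a fake coin realizes the run with two fake coins. -/
theorem reaches_ffRun (x y : Fin N) (t : FCTree N) : Reaches x y t (ffRun x y t) := by
  induction t with
  | output S => exact .output S
  | weigh A B child ih =>
    refine .weigh A B child true _ ?_
    simpa only [weighOutcome, coinWeight_true, ffRun] using ih _

/-- The number of coins of `A` among `a` and `b`, counted once if `a = b`. -/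
def lightCount (a b : Fin N) (A : Finset (Fin N)) : ℕ :=
  (if a ∈ A then 1 else 0) + if b ∈ A ∧ a ≠ b then 1 else 0

theorem sum_ffWeight_add_lightCount (x y : Fin N) (P : Finset (Fin N)) :
    ∑ z ∈ P, ffWeight x y z + lightCount x y P = P.card := by
  have h : ∀ z, ffWeight x y z + ((if x = z then 1 else 0) +
      if y = z then (if x ≠ y then 1 else 0) else 0) = 1 := by
    intro z
    unfold ffWeight
    grind
  have key := Finset.sum_congr (rfl : P = P) fun z _ => h z
  rw [Finset.sum_add_distrib, Finset.sum_add_distrib, Finset.sum_ite_eq, Finset.sum_ite_eq,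
    ← Finset.card_eq_sum_ones] at key
  rw [← key, lightCount, ite_and]

theorem lightCount_comm (a b : Fin N) (A : Finset (Fin N)) :
    lightCount a b A = lightCount b a A := by
  unfold lightCount
  grind

end Weights

section Scaling

variable {N : ℕ}

/-- The `i`-th coin of the group replacing the coin `a`. -/
def groupCoin (a : Fin N) (i : Fin 3) : Fin (3 * N) := ⟨3 * a.val + i.val, by omega⟩

@[simp] theorem coinGroup_groupCoin (a : Fin N) (i : Fin 3) :
    coinGroup (groupCoin a i) = a := by
  ext
  simp only [coinGroup, groupCoin]
  omega

theorem groupCoin_inj {a b : Fin N} {i j : Fin 3} :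
    groupCoin a i = groupCoin b j ↔ a = b ∧ i = j := by
  simp only [groupCoin, Fin.ext_iff]
  omega

theorem mem_expandPan {A : Finset (Fin N)} {x : Fin (3 * N)} :
    x ∈ expandPan A ↔ coinGroup x ∈ A := by
  simp [expandPan]

theorem card_expandPan (A : Finset (Fin N)) : (expandPan A).card = 3 * A.card := by
  have h : expandPan A = (A ×ˢ Finset.univ).image fun p => groupCoin p.1 p.2 := by
    ext x
    simp only [mem_expandPan, Finset.mem_image, Finset.mem_product, Finset.mem_univ, and_true]
    constructor
    · intro hx
      refine ⟨(coinGroup x, ⟨x.val % 3, by omega⟩), hx, ?_⟩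
      ext
      simp only [groupCoin, coinGroup]
      omega
    · rintro ⟨p, hp, rfl⟩
      simpa using hp
  rw [h, Finset.card_image_of_injective, Finset.card_product, Finset.card_univ, Fintype.card_fin,
    mul_comm]
  rintro ⟨a, i⟩ ⟨b, j⟩ hab
  obtain ⟨rfl, rfl⟩ := groupCoin_inj.1 hab
  rfl

/-- The outcome of weighing the groups of `A` against the groups of `B` when the groups
containing light coins are `a` and `b`. -/
def groupOutcome (a b : Fin N) (A B : Finset (Fin N)) : Ordering :=
  compare (3 * A.card + lightCount a b B) (3 * B.card + lightCount a b A)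

theorem compare_congr {k l m n : ℕ} (h₁ : k < l ↔ m < n) (h₂ : l < k ↔ n < m) :
    compare k l = compare m n := by
  simp only [Nat.compare_eq_ite_lt, h₁, h₂]

theorem compare_ffWeight_expandPan (x y : Fin (3 * N)) (A B : Finset (Fin N)) :
    compare (∑ z ∈ expandPan A, ffWeight x y z) (∑ z ∈ expandPan B, ffWeight x y z) =
      groupOutcome (coinGroup x) (coinGroup y) A B := by
  have hA := sum_ffWeight_add_lightCount x y (expandPan A)
  have hB := sum_ffWeight_add_lightCount x y (expandPan B)
  rw [card_expandPan] at hA hB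
  simp only [lightCount, mem_expandPan] at hA hB
  by_cases hxy : x = y
  · subst hxy
    apply compare_congr <;> simp only [lightCount] <;> simp at hA hB ⊢ <;> split_ifs at * <;> omega
  · by_cases hg : coinGroup x = coinGroup y
    · apply compare_congr <;> simp only [lightCount] <;> simp [hg, hxy] at hA hB ⊢ <;>
        split_ifs at * <;> omega
    · apply compare_congr <;> simp only [lightCount] <;> simp [hg, hxy] at hA hB ⊢ <;>
        split_ifs at * <;> omega

/-- The leaf of `t` that the scaling of `t` arrives at when the groups containing light coins
are `a` and `b`. -/
def groupRun (a b : Fin N) : FCTree N → Finset (Fin N)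
  | .output S => S
  | .weigh A B child => groupRun a b (child (groupOutcome a b A B))

theorem groupRun_comm (a b : Fin N) (t : FCTree N) : groupRun a b t = groupRun b a t := by
  induction t with
  | output S => rfl
  | weigh A B child ih => simp only [groupRun, groupOutcome, lightCount_comm a b, ih]

theorem groupRun_mem_outputs (a b : Fin N) (t : FCTree N) : groupRun a b t ∈ t.outputs := by
  induction t with
  | output S => simp [groupRun, FCTree.outputs]
  | weigh A B child ih => exact FCTree.outputs_child_subset A B child _ (ih _)

variable {ext : Finset (Fin N) → FCTree (3 * N)} {x y : Fin (3 * N)} {t : FCTree N}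

theorem Reaches.scaleExtend_of_fake {S : Finset (Fin (3 * N))}
    (h : Reaches x y (ext (groupRun (coinGroup x) (coinGroup y) t)) S) :
    Reaches x y (scaleExtend ext t) S := by
  induction t with
  | output _ => exact h
  | weigh A B child ih =>
    refine .weigh _ _ _ true _ ?_
    rw [weighOutcome, coinWeight_true, compare_ffWeight_expandPan]
    exact ih _ h

theorem Reaches.scaleExtend_of_real {S : Finset (Fin (3 * N))}
    (h : Reaches x y (ext (groupRun (coinGroup x) (coinGroup x) t)) S) :
    Reaches x y (scaleExtend ext t) S := by
  induction t with
  | output _ => exact h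
  | weigh A B child ih =>
    refine .weigh _ _ _ false _ ?_
    rw [weighOutcome, coinWeight_false, compare_ffWeight_expandPan]
    exact ih _ h

theorem IsFCSolution.eq_pair {M v : ℕ} {u : FCTree M} (hu : IsFCSolution u v) {x y : Fin M}
    (hxy : x ≠ y) {S : Finset (Fin M)} (h₁ : Reaches x y u S) (h₂ : Reaches y x u S) :
    S = {x, y} := by
  obtain ⟨hcard, hx⟩ := hu.2.2 x y hxy S h₁
  have hy := (hu.2.2 y x hxy.symm S h₂).2
  symm
  apply Finset.eq_of_subset_of_card_le
  · simp [Finset.insert_subset_iff, hx, hy]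
  · rwa [Finset.card_pair hxy]

theorem ffRun_ext_groupRun {v : ℕ} (hu : IsFCSolution (scaleExtend ext t) v) (hxy : x ≠ y) :
    ffRun x y (ext (groupRun (coinGroup x) (coinGroup y) t)) = {x, y} := by
  refine hu.eq_pair hxy (reaches_ffRun _ _ _).scaleExtend_of_fake
    (Reaches.scaleExtend_of_fake ?_)
  rw [groupRun_comm, ffRun_comm]
  exact reaches_ffRun _ _ _

/-- The chameleon weighs as a real coin until the extension starts, and as a fake coin
afterwards. -/
theorem ffRun_ext_groupRun_self {v : ℕ} (hu : IsFCSolution (scaleExtend ext t) v) (hxy : x ≠ y)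
    (h : groupRun (coinGroup x) (coinGroup x) t = groupRun (coinGroup y) (coinGroup y) t) :
    ffRun x y (ext (groupRun (coinGroup x) (coinGroup x) t)) = {x, y} := by
  refine hu.eq_pair hxy (reaches_ffRun _ _ _).scaleExtend_of_real
    (Reaches.scaleExtend_of_real ?_)
  rw [h, ffRun_comm]
  exact reaches_ffRun _ _ _

/-- Two weighings cannot identify both the nine pairs from two groups and one further pair. -/
theorem two_lt_depth_of_ffRun_eq {u : FCTree (3 * N)} {a b : Fin N} (hab : a ≠ b)
    (h : ∀ i j, ffRun (groupCoin a i) (groupCoin b j) u = {groupCoin a i, groupCoin b j})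
    (hxy : ffRun x y u = {x, y}) (hne : s(coinGroup x, coinGroup y) ≠ s(a, b)) :
    2 < u.depth := by
  by_contra! hd
  let pair : Fin 3 × Fin 3 → Finset (Fin (3 * N)) :=
    fun p => {groupCoin a p.1, groupCoin b p.2}
  have hinj : Function.Injective pair := by
    rintro ⟨i, j⟩ ⟨k, l⟩ hp
    have h₁ : groupCoin a i ∈ pair (k, l) := hp ▸ by simp [pair]
    have h₂ : groupCoin b j ∈ pair (k, l) := hp ▸ by simp [pair]
    simp only [pair, Finset.mem_insert, Finset.mem_singleton, groupCoin_inj] at h₁ h₂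
    grind
  have hnot : ({x, y} : Finset (Fin (3 * N))) ∉ Finset.univ.image pair := by
    simp only [Finset.mem_image, Finset.mem_univ, true_and, not_exists]
    intro p hp
    have h' := congrArg (Finset.image coinGroup) hp
    simp only [pair, Finset.image_insert, Finset.image_singleton, coinGroup_groupCoin] at h'
    have hs := congrArg (fun s : Finset (Fin N) => (s : Set (Fin N))) h'
    simp only [Finset.coe_insert, Finset.coe_singleton] at hs
    rw [Set.pair_eq_pair_iff] at hs
    exact hne (Sym2.eq_iff.2 (by tauto))
  have hsub : insert {x, y} (Finset.univ.image pair) ⊆ u.outputs := by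
    intro S hS
    rcases Finset.mem_insert.1 hS with rfl | hS
    · exact hxy ▸ ffRun_mem_outputs _ _ _
    · obtain ⟨p, -, rfl⟩ := Finset.mem_image.1 hS
      have hp := ffRun_mem_outputs (groupCoin a p.1) (groupCoin b p.2) u
      rwa [h] at hp
  have hcard := (Finset.card_le_card hsub).trans
    (u.card_outputs_le.trans (Nat.pow_le_pow_right (by norm_num) hd))
  rw [Finset.card_insert_of_notMem hnot, Finset.card_image_of_injective _ hinj] at hcard
  simp at hcard

theorem groupRun_ne_of_ne {v : ℕ} (hu : IsFCSolution (scaleExtend ext t) v)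
    (hd : ∀ S, (ext S).depth ≤ 2) {a b c d : Fin N} (hab : a ≠ b) (hne : s(c, d) ≠ s(a, b)) :
    groupRun c d t ≠ groupRun a b t := by
  intro h
  have hcd : groupCoin c 0 ≠ groupCoin d 1 := by simp [groupCoin_inj]
  refine (hd (groupRun a b t)).not_gt
    (two_lt_depth_of_ffRun_eq (x := groupCoin c 0) (y := groupCoin d 1) hab ?_ ?_
      (by simpa only [coinGroup_groupCoin] using hne))
  · intro i j
    have hij : groupCoin a i ≠ groupCoin b j := by simp [groupCoin_inj, hab]
    simpa using ffRun_ext_groupRun hu hij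
  · rw [← h]
    simpa using ffRun_ext_groupRun hu hcd

theorem groupRun_self_injective {v : ℕ} (hu : IsFCSolution (scaleExtend ext t) v)
    (hd : ∀ S, (ext S).depth ≤ 2) : Function.Injective fun a => groupRun a a t := by
  intro a b h
  by_contra hab
  have h01 : groupCoin a 0 ≠ groupCoin a 1 := by simp [groupCoin_inj]
  refine (hd (groupRun a a t)).not_gt
    (two_lt_depth_of_ffRun_eq (x := groupCoin a 0) (y := groupCoin a 1) hab ?_ ?_ ?_)
  · intro i j
    have hij : groupCoin a i ≠ groupCoin b j := by simp [groupCoin_inj, hab]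
    simpa using ffRun_ext_groupRun_self hu hij (by simpa using h)
  · simpa using ffRun_ext_groupRun hu h01
  · simpa using hab

theorem IsScalable.choose_two_le {w : ℕ} (ht : t.depth ≤ w) (hscal : IsScalable t w) :
    (N + 1).choose 2 ≤ 3 ^ w := by
  obtain ⟨ext, hext, hu⟩ := hscal
  have hd : ∀ S, (ext S).depth ≤ 2 := fun S => (hext S).2
  let run : Sym2 (Fin N) → Finset (Fin N) :=
    Sym2.lift ⟨fun a b => groupRun a b t, fun a b => groupRun_comm a b t⟩
  have hinj : Function.Injective run := by
    intro p q
    induction p with | _ a b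
    induction q with | _ c d
    intro (h : groupRun a b t = groupRun c d t)
    by_contra hne
    by_cases hab : a = b
    · by_cases hcd : c = d
      · subst hab hcd
        exact hne (by rw [groupRun_self_injective hu hd h])
      · exact groupRun_ne_of_ne hu hd hcd hne h
    · exact groupRun_ne_of_ne hu hd hab (Ne.symm hne) h.symm
  calc (N + 1).choose 2 = (Finset.univ.image run).card := by
        rw [Finset.card_image_of_injective _ hinj, Finset.card_univ, Sym2.card, Fintype.card_fin]
    _ ≤ t.outputs.card := by
        refine Finset.card_le_card fun S hS => ?_
        obtain ⟨p, -, rfl⟩ := Finset.mem_image.1 hS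
        induction p with | _ a b
        exact groupRun_mem_outputs a b t
    _ ≤ 3 ^ w := t.card_outputs_le.trans (Nat.pow_le_pow_right (by norm_num) ht)

end Scaling

/-- For a scalable (w,N)-solution, N(N+1)/2 ≤ 3^w; equivalently,
N ≤ ⌊√(2·3^w + 1/4) − 1/2⌋. -/
theorem scalable_information_theoretic_bound (N w : ℕ) (t : FCTree N)
    (ht : IsFCSolution t w) (hscal : IsScalable t w) :
    N * (N + 1) / 2 ≤ 3 ^ w ∧
    (N : ℤ) ≤ ⌊Real.sqrt (2 * (3 : ℝ) ^ w + 1 / 4) - 1 / 2⌋ := by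
  have key : N * (N + 1) / 2 ≤ 3 ^ w := by
    simpa [Nat.choose_two_right, mul_comm] using hscal.choose_two_le ht.2.1
  refine ⟨key, ?_⟩
  have hnat : N * (N + 1) ≤ 2 * 3 ^ w := by
    have := (Nat.even_mul_succ_self N).two_dvd
    omega
  have hreal : (N : ℝ) * (N + 1) ≤ 2 * 3 ^ w := by exact_mod_cast hnat
  have hsqrt : (N : ℝ) + 1 / 2 ≤ Real.sqrt (2 * (3 : ℝ) ^ w + 1 / 4) :=
    Real.le_sqrt_of_sq_le (by linarith)
  rw [Int.le_floor]
  push_cast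
  linarith
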